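/- Suppose the Kato–Jones density g_KJ(·; μ, γ, λ, ρ) with γ > 0 can be written as a two-component mixture g_KJ(θ) = π₁ h₁(θ) + π₂ h₂(θ) for all θ ∈ [−π, π), where π₁, π₂ > 0 with π₁ + π₂ = 1, and for j = 1, 2 the function h_j is a probability density on [−π, π) that is symmetric about some μ_j ∈ [−π, π) (i.e., h_j(μ_j + t) = h_j(μ_j − t) for all t, with arguments interpreted modulo 2π) and satisfies ∫_{−π}^{π} cos(p(θ − μ_j)) h_j(θ) dθ > 0 for every positive integer p. Then g_KJ is symmetric, i.e., λ = 0 or λ = −π (equivalently, sin λ = 0). -/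

import Mathlib

/-- The Kato–Jones density with parameters `μ` (location), `γ` (concentration),
`lam` (skewness angle) and `ρ` (kurtosis-related parameter). -/
noncomputable def gKJ (μ γ lam ρ θ : ℝ) : ℝ :=
  (1 / (2 * Real.pi)) *
    (1 + 2 * γ * (Real.cos (θ - μ) - ρ * Real.cos lam) /
      (1 + ρ ^ 2 - 2 * ρ * Real.cos (θ - μ - lam)))

open Real Filter Topology in
/-- Two rotations of the circle are simultaneously close to the identity for some positive
iterate, so a nonzero sine keeps its sign under both of them. -/
lemma exists_pos_nat_sin_mul_sin_pos (x y lam : ℝ) (h : sin lam ≠ 0) :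
    ∃ p : ℕ, 0 < p ∧ 0 < sin lam * sin (p * x + lam) ∧ 0 < sin lam * sin (p * y + lam) := by
  let F : Circle → ℝ := fun z => sin lam * ((z : ℂ).im * cos lam + (z : ℂ).re * sin lam)
  have hF : Continuous F := by fun_prop
  have hexp : ∀ (t : ℝ) (p : ℕ), F (Circle.exp t ^ p) = sin lam * sin (p * t + lam) := by
    intro t p
    have : ((Circle.exp t ^ p : Circle) : ℂ) = Complex.exp ((p * t : ℝ) * Complex.I) := by
      rw [Circle.coe_pow, Circle.coe_exp, ← Complex.exp_nat_mul]
      push_cast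
      ring_nf
    simp only [F, this, Complex.exp_ofReal_mul_I_im, Complex.exp_ofReal_mul_I_re, sin_add]
  have hone : 0 < F 1 := by
    have : F 1 = sin lam ^ 2 := by simp [F, sq]
    rw [this]
    positivity
  have hU : {z : Circle × Circle | 0 < F z.1 ∧ 0 < F z.2} ∈ 𝓝 (1 : Circle × Circle) :=
    ((isOpen_lt continuous_const (hF.comp continuous_fst)).inter
      (isOpen_lt continuous_const (hF.comp continuous_snd))).mem_nhds ⟨hone, hone⟩
  have hfreq := (mapClusterPt_one_atTop_pow (Circle.exp x, Circle.exp y)).frequently hU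
  obtain ⟨p, hp, hp0⟩ := (hfreq.and_eventually (eventually_gt_atTop 0)).exists
  refine ⟨p, hp0, ?_, ?_⟩
  · simpa [← hexp] using hp.1
  · simpa [← hexp] using hp.2

/-- The integral of an odd function over a symmetric interval vanishes. -/
lemma intervalIntegral_eq_zero_of_odd {f : ℝ → ℝ} (hf : ∀ t, f (-t) = -f t) (a : ℝ) :
    ∫ t in (-a)..a, f t = 0 := by
  have h := intervalIntegral.integral_comp_neg (a := -a) (b := a) f
  simp only [hf, intervalIntegral.integral_neg, neg_neg] at h
  linarith

open Real in
/-- Recentring an integral over a full period. -/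
lemma periodic_intervalIntegral_eq_shift {f : ℝ → ℝ} (hf : Function.Periodic f (2 * π)) (m : ℝ) :
    ∫ θ in (-π)..π, f θ = ∫ t in (-π)..π, f (m + t) := by
  rw [intervalIntegral.integral_comp_add_left]
  have h := hf.intervalIntegral_add_eq (-π) (m + -π)
  convert h using 2 <;> ring

open Real in
lemma periodic_sin_nat_mul_sub_add (p : ℕ) (a lam : ℝ) :
    Function.Periodic (fun θ => sin (p * (θ - a) + lam)) (2 * π) := by
  intro θ
  have : p * (θ + 2 * π - a) + lam = p * (θ - a) + lam + p * (2 * π) := by ring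
  simp only [this, sin_add_nat_mul_two_pi]

open Real in
/-- Sine moments of a density symmetric about `m` reduce to its cosine moments about `m`. -/
lemma integral_sin_mul_of_symmetric {h : ℝ → ℝ} {m : ℝ}
    (hint : IntervalIntegrable h MeasureTheory.volume (-π) π)
    (hper : Function.Periodic h (2 * π)) (hsym : ∀ t, h (m + t) = h (m - t))
    (p : ℕ) (a lam : ℝ) :
    ∫ θ in (-π)..π, sin (p * (θ - a) + lam) * h θ =
      sin (p * (m - a) + lam) * ∫ θ in (-π)..π, cos (p * (θ - m)) * h θ := by
  have hzero : ∫ θ in (-π)..π, sin (p * (θ - m)) * h θ = 0 := by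
    rw [periodic_intervalIntegral_eq_shift (m := m)]
    · apply intervalIntegral_eq_zero_of_odd
      intro t
      have : p * (m + -t - m) = -(p * (m + t - m)) := by ring
      rw [this, sin_neg, ← sub_eq_add_neg, hsym]
      ring
    · simpa using (periodic_sin_nat_mul_sub_add p m 0).mul hper
  have hsplit : ∀ θ, sin (p * (θ - a) + lam) * h θ =
      sin (p * (m - a) + lam) * (cos (p * (θ - m)) * h θ) +
        cos (p * (m - a) + lam) * (sin (p * (θ - m)) * h θ) := by
    intro θ
    have : p * (θ - a) + lam = (p * (m - a) + lam) + p * (θ - m) := by ring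
    rw [this, sin_add]
    ring
  have hc : IntervalIntegrable (fun θ => cos (p * (θ - m)) * h θ) MeasureTheory.volume (-π) π :=
    hint.continuousOn_mul (by fun_prop)
  have hs : IntervalIntegrable (fun θ => sin (p * (θ - m)) * h θ) MeasureTheory.volume (-π) π :=
    hint.continuousOn_mul (by fun_prop)
  simp_rw [hsplit]
  rw [intervalIntegral.integral_add (hc.const_mul _) (hs.const_mul _),
    intervalIntegral.integral_const_mul, intervalIntegral.integral_const_mul, hzero, mul_zero,
    add_zero]

lemma one_add_sq_sub_two_mul_cos_pos {ρ : ℝ} (hρ : ρ ∈ Set.Ico (0 : ℝ) 1) (u : ℝ) :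
    0 < 1 + ρ ^ 2 - 2 * ρ * Real.cos u := by
  obtain ⟨h0, h1⟩ := hρ
  nlinarith [mul_le_mul_of_nonneg_left (Real.cos_le_one u) h0, sq_pos_of_pos (sub_pos.2 h1)]

open Real in
lemma integral_cos_nat_mul_eq_zero {p : ℕ} (hp : p ≠ 0) :
    ∫ u in (-π)..π, cos (p * u) = 0 := by
  have : (p : ℝ) ≠ 0 := by exact_mod_cast hp
  rw [intervalIntegral.integral_comp_mul_left _ this]
  simp [sin_nat_mul_pi]

open Real in
lemma integral_sin_nat_mul_add_eq_zero {p : ℕ} (hp : p ≠ 0) (lam : ℝ) :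
    ∫ u in (-π)..π, sin (p * u + lam) = 0 := by
  have : (p : ℝ) ≠ 0 := by exact_mod_cast hp
  rw [intervalIntegral.integral_comp_mul_add _ this, integral_sin]
  have : p * -π + lam = p * π + lam - p * (2 * π) := by ring
  rw [this, cos_sub_nat_mul_two_pi]
  simp

open Real in
/-- The Fourier coefficients of the Poisson kernel form a geometric progression of ratio `ρ`. -/
lemma integral_cos_succ_sub_div_eq_zero {ρ : ℝ} (hρ : ρ ∈ Set.Ico (0 : ℝ) 1) (p : ℕ) :
    ∫ u in (-π)..π, (cos ((p + 1 : ℕ) * u) - ρ * cos (p * u)) / (1 + ρ ^ 2 - 2 * ρ * cos u)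
      = 0 := by
  have hD := one_add_sq_sub_two_mul_cos_pos hρ
  obtain ⟨h0, h1⟩ := hρ
  set J : ℕ → ℝ := fun p => ∫ u in (-π)..π,
    (cos ((p + 1 : ℕ) * u) - ρ * cos (p * u)) / (1 + ρ ^ 2 - 2 * ρ * cos u) with hJ
  have hcont : ∀ p : ℕ, Continuous fun u =>
      (cos ((p + 1 : ℕ) * u) - ρ * cos (p * u)) / (1 + ρ ^ 2 - 2 * ρ * cos u) := fun p =>
    Continuous.div (by fun_prop) (by fun_prop) fun u => (hD u).ne'
  have hrec : ∀ q, J q = ρ * J (q + 1) := by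
    intro q
    rw [← sub_eq_zero]
    simp only [hJ]
    rw [← intervalIntegral.integral_const_mul, ← intervalIntegral.integral_sub
      ((hcont q).intervalIntegrable _ _) (((hcont (q + 1)).const_mul ρ).intervalIntegrable _ _),
      ← integral_cos_nat_mul_eq_zero q.succ_ne_zero]
    congr 1
    ext u
    have hne := (hD u).ne'
    have e1 : cos ((q + 1 + 1 : ℕ) * u) = cos ((q + 1 : ℕ) * u) * cos u
        - sin ((q + 1 : ℕ) * u) * sin u := by
      rw [← cos_add]; push_cast; ring_nf
    have e2 : cos (q * u) = cos ((q + 1 : ℕ) * u) * cos u + sin ((q + 1 : ℕ) * u) * sin u := by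
      rw [← cos_sub]; push_cast; ring_nf
    rw [e1, e2, mul_div_assoc', ← sub_div, div_eq_iff hne]
    ring
  have hiter : ∀ k, J p = ρ ^ k * J (p + k) := by
    intro k
    induction k with
    | zero => simp
    | succ k ih => rw [ih, hrec (p + k), pow_succ, mul_assoc, add_assoc]
  have hbound : ∀ q, |J q| ≤ 2 / (1 - ρ) ^ 2 * |π - -π| := by
    intro q
    rw [← norm_eq_abs]
    refine intervalIntegral.norm_integral_le_of_norm_le_const fun u _ => ?_
    have hpos : 0 < (1 - ρ) ^ 2 := by nlinarith
    rw [norm_eq_abs, abs_div, abs_of_pos (hD u)]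
    refine div_le_div₀ (by norm_num) ?_ hpos ?_
    · calc |cos ((q + 1 : ℕ) * u) - ρ * cos (q * u)|
          ≤ |cos ((q + 1 : ℕ) * u)| + |ρ * cos (q * u)| := abs_sub _ _
        _ ≤ 1 + 1 := by
            rw [abs_mul, abs_of_nonneg h0]
            exact add_le_add (abs_cos_le_one _)
              (mul_le_one₀ h1.le (abs_nonneg _) (abs_cos_le_one _))
        _ = 2 := by norm_num
    · nlinarith [mul_le_mul_of_nonneg_left (cos_le_one u) h0]
  have hlim : Filter.Tendsto (fun k => ρ ^ k * J (p + k)) Filter.atTop (nhds 0) :=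
    (tendsto_pow_atTop_nhds_zero_of_lt_one h0 h1).zero_mul_isBoundedUnder_le
      (Filter.isBoundedUnder_of ⟨_, fun k => hbound (p + k)⟩)
  exact tendsto_nhds_unique (tendsto_const_nhds.congr hiter) hlim

open Real in
lemma periodic_gKJ (μ γ lam ρ : ℝ) : Function.Periodic (gKJ μ γ lam ρ) (2 * π) := by
  intro θ
  have e1 : θ + 2 * π - μ = θ - μ + 2 * π := by ring
  have e2 : θ - μ + 2 * π - lam = θ - μ - lam + 2 * π := by ring
  simp only [gKJ, e1, e2, cos_add_two_pi]

open Real in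
/-- Every trigonometric moment of order `p ≥ 1` of the Kato–Jones density about `μ + λ` has
argument `-λ` (or vanishes). -/
lemma integral_sin_mul_gKJ {ρ : ℝ} (hρ : ρ ∈ Set.Ico (0 : ℝ) 1) (μ γ lam : ℝ)
    {p : ℕ} (hp : p ≠ 0) :
    ∫ θ in (-π)..π, sin (p * (θ - (μ + lam)) + lam) * gKJ μ γ lam ρ θ = 0 := by
  have hD := one_add_sq_sub_two_mul_cos_pos hρ
  have hper : Function.Periodic
      (fun θ => sin (p * (θ - (μ + lam)) + lam) * gKJ μ γ lam ρ θ) (2 * π) :=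
    (periodic_sin_nat_mul_sub_add p (μ + lam) lam).mul (periodic_gKJ μ γ lam ρ)
  rw [periodic_intervalIntegral_eq_shift hper (μ + lam)]
  let E : ℝ → ℝ := fun u =>
    (cos ((p + 1 : ℕ) * u) - ρ * cos (p * u)) / (1 + ρ ^ 2 - 2 * ρ * cos u)
  let O : ℝ → ℝ := fun u =>
    (cos lam ^ 2 * (sin (p * u) * (cos u - ρ)) - sin lam ^ 2 * (cos (p * u) * sin u)) /
      (1 + ρ ^ 2 - 2 * ρ * cos u)
  have hE : Continuous E := Continuous.div (by fun_prop) (by fun_prop) fun u => (hD u).ne'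
  have hO : Continuous O := Continuous.div (by fun_prop) (by fun_prop) fun u => (hD u).ne'
  have hOdd : ∫ u in (-π)..π, O u = 0 := by
    apply intervalIntegral_eq_zero_of_odd
    intro u
    simp only [O, mul_neg, sin_neg, cos_neg]
    ring
  have hsplit : ∀ u, sin (p * (μ + lam + u - (μ + lam)) + lam) * gKJ μ γ lam ρ (μ + lam + u) =
      1 / (2 * π) * sin (p * u + lam) +
        (γ / π * (sin lam * cos lam) * E u + γ / π * O u) := by
    intro u
    have hne := (hD u).ne'
    have e1 : μ + lam + u - (μ + lam) = u := by ring
    have e2 : μ + lam + u - μ = u + lam := by ring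
    have e3 : u + lam - lam = u := by ring
    have e4 : ((p + 1 : ℕ) : ℝ) * u = p * u + u := by push_cast; ring
    simp only [gKJ, E, O, e1, e2, e3, e4, sin_add, cos_add]
    field_simp
    ring
  simp_rw [hsplit]
  rw [intervalIntegral.integral_add, intervalIntegral.integral_add,
    intervalIntegral.integral_const_mul, intervalIntegral.integral_const_mul,
    intervalIntegral.integral_const_mul, hOdd, integral_sin_nat_mul_add_eq_zero hp,
    integral_cos_succ_sub_div_eq_zero hρ p]
  · ring
  all_goals exact Continuous.intervalIntegrable (by fun_prop) _ _

/-- If a Kato–Jones density (with `γ > 0`) can be written as a two-component mixture of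
symmetric circular densities with positive cosine moments, then it is symmetric,
i.e. `λ = 0` or `λ = -π`. -/
theorem kato_jones_symmetric_mixture_implies_symmetry
    (μ γ lam ρ : ℝ)
    (hμ : μ ∈ Set.Ico (-Real.pi) Real.pi)
    (hγ0 : 0 < γ) (hγ1 : γ < 1)
    (hρ : ρ ∈ Set.Ico (0 : ℝ) 1)
    (hlam : lam ∈ Set.Ico (-Real.pi) Real.pi)
    (hconstraint : (ρ * Real.cos lam - γ) ^ 2 + (ρ * Real.sin lam) ^ 2 ≤ (1 - γ) ^ 2)
    (π₁ π₂ : ℝ) (hπ₁ : 0 < π₁) (hπ₂ : 0 < π₂) (hπsum : π₁ + π₂ = 1)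
    (h₁ h₂ : ℝ → ℝ) (μ₁ μ₂ : ℝ)
    (hμ₁ : μ₁ ∈ Set.Ico (-Real.pi) Real.pi)
    (hμ₂ : μ₂ ∈ Set.Ico (-Real.pi) Real.pi)
    (hmeas₁ : Measurable h₁) (hmeas₂ : Measurable h₂)
    (hnn₁ : ∀ θ, 0 ≤ h₁ θ) (hnn₂ : ∀ θ, 0 ≤ h₂ θ)
    (hper₁ : Function.Periodic h₁ (2 * Real.pi))
    (hper₂ : Function.Periodic h₂ (2 * Real.pi))
    (hint₁ : ∫ θ in (-Real.pi)..Real.pi, h₁ θ = 1)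
    (hint₂ : ∫ θ in (-Real.pi)..Real.pi, h₂ θ = 1)
    (hsym₁ : ∀ t, h₁ (μ₁ + t) = h₁ (μ₁ - t))
    (hsym₂ : ∀ t, h₂ (μ₂ + t) = h₂ (μ₂ - t))
    (hposmom₁ : ∀ p : ℕ, 0 < p →
      0 < ∫ θ in (-Real.pi)..Real.pi, Real.cos (p * (θ - μ₁)) * h₁ θ)
    (hposmom₂ : ∀ p : ℕ, 0 < p →
      0 < ∫ θ in (-Real.pi)..Real.pi, Real.cos (p * (θ - μ₂)) * h₂ θ)
    (hmix : ∀ θ ∈ Set.Ico (-Real.pi) Real.pi,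
      gKJ μ γ lam ρ θ = π₁ * h₁ θ + π₂ * h₂ θ) :
    lam = 0 ∨ lam = -Real.pi := by
  have hi₁ : IntervalIntegrable h₁ MeasureTheory.volume (-Real.pi) Real.pi :=
    not_imp_comm.1 intervalIntegral.integral_undef (by simp [hint₁])
  have hi₂ : IntervalIntegrable h₂ MeasureTheory.volume (-Real.pi) Real.pi :=
    not_imp_comm.1 intervalIntegral.integral_undef (by simp [hint₂])
  have hsin : Real.sin lam = 0 := by
    by_contra hne
    obtain ⟨p, hp, hx, hy⟩ :=
      exists_pos_nat_sin_mul_sin_pos (μ₁ - (μ + lam)) (μ₂ - (μ + lam)) lam hne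
    have hmom := integral_sin_mul_gKJ hρ μ γ lam hp.ne'
    have hcongr : ∫ θ in (-Real.pi)..Real.pi,
          Real.sin (p * (θ - (μ + lam)) + lam) * gKJ μ γ lam ρ θ =
        ∫ θ in (-Real.pi)..Real.pi,
          (π₁ * (Real.sin (p * (θ - (μ + lam)) + lam) * h₁ θ) +
            π₂ * (Real.sin (p * (θ - (μ + lam)) + lam) * h₂ θ)) := by
      refine intervalIntegral.integral_congr_Ioo_of_le (by linarith [Real.pi_pos]) fun θ hθ => ?_
      simp only [hmix θ ⟨hθ.1.le, hθ.2⟩]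
      ring
    have hs₁ : IntervalIntegrable (fun θ => Real.sin (p * (θ - (μ + lam)) + lam) * h₁ θ)
        MeasureTheory.volume (-Real.pi) Real.pi := hi₁.continuousOn_mul (by fun_prop)
    have hs₂ : IntervalIntegrable (fun θ => Real.sin (p * (θ - (μ + lam)) + lam) * h₂ θ)
        MeasureTheory.volume (-Real.pi) Real.pi := hi₂.continuousOn_mul (by fun_prop)
    rw [hcongr, intervalIntegral.integral_add (hs₁.const_mul _) (hs₂.const_mul _),
      intervalIntegral.integral_const_mul, intervalIntegral.integral_const_mul,
      integral_sin_mul_of_symmetric hi₁ hper₁ hsym₁, integral_sin_mul_of_symmetric hi₂ hper₂ hsym₂]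
      at hmom
    have t₁ := mul_pos hπ₁ (mul_pos hx (hposmom₁ p hp))
    have t₂ := mul_pos hπ₂ (mul_pos hy (hposmom₂ p hp))
    have := congrArg (Real.sin lam * ·) hmom
    simp only [mul_zero] at this
    linarith
  rcases hlam.1.eq_or_lt with h | h
  · exact Or.inr h.symm
  · exact Or.inl ((Real.sin_eq_zero_iff_of_lt_of_lt h hlam.2).1 hsin)
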